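/- Let n ≥ 11, let W be a four-linear form on ℝⁿ with the symmetries of a Weyl tensor, let h be its associated quadratic field, and fix t > 0. Define F₁(t,z) = (1/4)∫_{ℝⁿ} ∑_{i,j,p=1}^n h_{ip}(x) h_{pj}(x) ∂_i B_{t,z}(x) ∂_j B_{t,z}(x) dx and F₂(t,z) = −((n−2)/(32(n−1))) ∫_{ℝⁿ} ∑_{i,j,l=1}^n (∂_i h_{jl}(x))² B_{t,z}(x)² dx. Then all second partial derivatives in z of the map z ↦ F₁(t,z) + F₂(t,z), evaluated at z = 0, vanish: ∂²_{z_k z_l}(F₁ + F₂)(t,z)|_{z=0} = 0 for all k, l ∈ {1,…,n}. -/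

import Mathlib

open MeasureTheory Real

noncomputable section

/-- The Euclidean space `ℝⁿ`. -/
abbrev En (n : ℕ) := EuclideanSpace ℝ (Fin n)

/-- Partial derivative in the `i`-th coordinate direction. -/
noncomputable def pd {n : ℕ} (i : Fin n) (f : En n → ℝ) (x : En n) : ℝ :=
  fderiv ℝ f x (EuclideanSpace.single i 1)

/-- The standard bubble `B_{t,z}(x) = t^{(n-2)/2} (t² + |x-z|²/(n(n-2)))^{-(n-2)/2}`. -/
noncomputable def Bub (n : ℕ) (t : ℝ) (z x : En n) : ℝ :=
  t ^ (((n : ℝ) - 2) / 2) *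
    (t ^ 2 + ‖x - z‖ ^ 2 / ((n : ℝ) * ((n : ℝ) - 2))) ^ (-(((n : ℝ) - 2) / 2))

/-- `W` has the symmetries of a Weyl tensor. -/
def IsWeyl (n : ℕ) (W : Fin n → Fin n → Fin n → Fin n → ℝ) : Prop :=
  (∀ i j k l, W i j k l = -W j i k l) ∧
  (∀ i j k l, W i j k l = -W i j l k) ∧
  (∀ i j k l, W i j k l = W k l i j) ∧
  (∀ j l, ∑ i, W i j i l = 0) ∧
  (∀ i j k l, W i j k l + W j k i l + W k i j l = 0)

/-- The quadratic field associated to `W`: `h_{ij}(x) = (1/3)∑_{p,q} W_{ipjq} x_p x_q`. -/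
noncomputable def hW (n : ℕ) (W : Fin n → Fin n → Fin n → Fin n → ℝ)
    (x : En n) (i j : Fin n) : ℝ :=
  (1 / 3) * ∑ p, ∑ q, W i p j q * x p * x q

/-- `F₁(t,z) = (1/4)∫ ∑_{i,j,p} h_{ip} h_{pj} ∂_i B_{t,z} ∂_j B_{t,z} dx`. -/
noncomputable def F1 (n : ℕ) (W : Fin n → Fin n → Fin n → Fin n → ℝ)
    (t : ℝ) (z : En n) : ℝ :=
  (1 / 4) * ∫ x : En n,
    ∑ i, ∑ j, ∑ p, hW n W x i p * hW n W x p j * pd i (Bub n t z) x * pd j (Bub n t z) x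

/-- `F₂(t,z) = -((n-2)/(32(n-1)))∫ ∑_{i,j,l} (∂_i h_{jl})² B_{t,z}² dx`. -/
noncomputable def F2 (n : ℕ) (W : Fin n → Fin n → Fin n → Fin n → ℝ)
    (t : ℝ) (z : En n) : ℝ :=
  -(((n : ℝ) - 2) / (32 * ((n : ℝ) - 1))) * ∫ x : En n,
    (∑ i, ∑ j, ∑ l, (pd i (fun y => hW n W y j l) x) ^ 2) * (Bub n t z x) ^ 2

/-- Continuous functions growing at most like `(1 + ‖y‖) ^ m`. -/
def PolyGrowth {n : ℕ} (m : ℕ) (g : En n → ℝ) : Prop :=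
  Continuous g ∧ ∃ K, 0 ≤ K ∧ ∀ y, |g y| ≤ K * (1 + ‖y‖) ^ m

namespace PolyGrowth

variable {n m m' : ℕ} {f g : En n → ℝ}

lemma const (r : ℝ) : PolyGrowth 0 (fun _ : En n => r) :=
  ⟨continuous_const, |r|, abs_nonneg r, fun y => by simp⟩

lemma coord (a : Fin n) : PolyGrowth 1 (fun y : En n => y a) := by
  refine ⟨by fun_prop, 1, zero_le_one, fun y => ?_⟩
  have := PiLp.norm_apply_le y a
  rw [Real.norm_eq_abs] at this
  linarith

lemma mono (hf : PolyGrowth m f) (h : m ≤ m') : PolyGrowth m' f := by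
  obtain ⟨hc, K, hK, hb⟩ := hf
  refine ⟨hc, K, hK, fun y => (hb y).trans ?_⟩
  have : 1 ≤ 1 + ‖y‖ := by linarith [norm_nonneg y]
  gcongr

lemma add (hf : PolyGrowth m f) (hg : PolyGrowth m g) : PolyGrowth m (fun y => f y + g y) := by
  obtain ⟨hc, K, hK, hb⟩ := hf
  obtain ⟨hc', K', hK', hb'⟩ := hg
  refine ⟨hc.add hc', K + K', by positivity, fun y => (abs_add_le _ _).trans ?_⟩
  linarith [hb y, hb' y]

lemma mul (hf : PolyGrowth m f) (hg : PolyGrowth m' g) :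
    PolyGrowth (m + m') (fun y => f y * g y) := by
  obtain ⟨hc, K, hK, hb⟩ := hf
  obtain ⟨hc', K', hK', hb'⟩ := hg
  refine ⟨hc.mul hc', K * K', by positivity, fun y => ?_⟩
  calc |f y * g y| = |f y| * |g y| := abs_mul _ _
    _ ≤ (K * (1 + ‖y‖) ^ m) * (K' * (1 + ‖y‖) ^ m') := by
        gcongr
        exacts [hb y, hb' y]
    _ = _ := by ring

lemma const_mul (r : ℝ) (hf : PolyGrowth m f) : PolyGrowth m (fun y => r * f y) := by
  simpa using (const r).mul hf

lemma sq (hf : PolyGrowth m f) : PolyGrowth (m + m) (fun y => f y ^ 2) := by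
  simpa only [pow_two] using hf.mul hf

lemma sum {ι : Type*} {s : Finset ι} {F : ι → En n → ℝ} (h : ∀ i, PolyGrowth m (F i)) :
    PolyGrowth m (fun y => ∑ i ∈ s, F i y) := by
  classical
  induction s using Finset.induction_on with
  | empty => simpa using (const (0 : ℝ)).mono (Nat.zero_le m)
  | insert a s ha ih => simpa only [Finset.sum_insert ha] using (h a).add ih

end PolyGrowth

/-- The profile `(t² + c|y|²)^{-s}`. -/
def profile {n : ℕ} (c t s : ℝ) (y : En n) : ℝ := (t ^ 2 + c * ‖y‖ ^ 2) ^ (-s)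

section profile

variable {n : ℕ} {c t s : ℝ}

lemma profile_base_pos (hc : 0 < c) (ht : 0 < t) (y : En n) : 0 < t ^ 2 + c * ‖y‖ ^ 2 := by
  positivity

lemma profile_mul_self (hc : 0 < c) (ht : 0 < t) (y : En n) :
    profile c t s y * profile c t s y = profile c t (2 * s) y := by
  rw [profile, profile, ← Real.rpow_add (profile_base_pos hc ht y)]
  congr 1
  ring

lemma hasFDerivAt_profile (hc : 0 < c) (ht : 0 < t) (y : En n) :
    HasFDerivAt (profile c t s)
      ((-(2 * c * s) * profile c t (s + 1) y) • innerSL ℝ y) y := by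
  have h1 : HasFDerivAt (fun y : En n => t ^ 2 + c * ‖y‖ ^ 2) (c • (2 • innerSL ℝ y)) y :=
    ((hasStrictFDerivAt_norm_sq y).hasFDerivAt.const_mul c).const_add _
  have h2 := h1.rpow_const (p := -s) (Or.inl (profile_base_pos hc ht y).ne')
  refine h2.congr_fderiv ?_
  ext v
  simp only [profile, smul_apply, smul_eq_mul, nsmul_eq_mul, Nat.cast_ofNat]
  rw [show -(s + 1) = -s - 1 by ring]
  ring

lemma continuous_profile (hc : 0 < c) (ht : 0 < t) :
    Continuous (profile c t s : En n → ℝ) :=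
  continuous_iff_continuousAt.2 fun y => (hasFDerivAt_profile hc ht y).continuousAt

lemma pd_profile (hc : 0 < c) (ht : 0 < t) (a : Fin n) (y : En n) :
    pd a (profile c t s) y = -(2 * c * s) * (y a * profile c t (s + 1) y) := by
  rw [pd, (hasFDerivAt_profile hc ht y).fderiv]
  simp [EuclideanSpace.inner_single_right]
  ring

lemma PolyGrowth.integrable_mul_profile {m : ℕ} {g : En n → ℝ} (hg : PolyGrowth m g)
    (hc : 0 < c) (ht : 0 < t) (hs : (n : ℝ) + m < 2 * s) :
    Integrable (fun y => g y * profile c t s y) := by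
  obtain ⟨hcont, K, hK, hb⟩ := hg
  have hs0 : 0 < s := by
    have : (0 : ℝ) ≤ n + m := by positivity
    linarith
  set κ : ℝ := min (t ^ 2) c / 2 with hκ
  have hmin : 0 < min (t ^ 2) c := lt_min (by positivity) hc
  have hκ0 : 0 < κ := by positivity
  have hint : Integrable (fun y : En n => (K * κ ^ (-s)) * (1 + ‖y‖) ^ (-(2 * s - m))) :=
    (integrable_one_add_norm (by simp; linarith)).const_mul _
  refine hint.mono' (hcont.mul (continuous_profile hc ht)).aestronglyMeasurable
    (Filter.Eventually.of_forall fun y => ?_)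
  have hy : 0 < 1 + ‖y‖ := by positivity
  have hbase : κ * (1 + ‖y‖) ^ 2 ≤ t ^ 2 + c * ‖y‖ ^ 2 := by
    have h1 : min (t ^ 2) c ≤ t ^ 2 := min_le_left _ _
    have h2 : min (t ^ 2) c ≤ c := min_le_right _ _
    have h3 : κ * (1 + ‖y‖) ^ 2 ≤ min (t ^ 2) c * (1 + ‖y‖ ^ 2) := by
      rw [hκ]; nlinarith [sq_nonneg (1 - ‖y‖)]
    nlinarith [sq_nonneg ‖y‖]
  have hp : profile c t s y ≤ κ ^ (-s) * (1 + ‖y‖) ^ (-(2 * s)) := by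
    calc profile c t s y ≤ (κ * (1 + ‖y‖) ^ 2) ^ (-s) :=
          Real.rpow_le_rpow_of_nonpos (by positivity) hbase (by linarith)
      _ = _ := by
          rw [Real.mul_rpow hκ0.le (by positivity), ← Real.rpow_natCast, ← Real.rpow_mul hy.le]
          congr 2
          push_cast
          ring
  have hp0 : 0 ≤ profile c t s y := Real.rpow_nonneg (profile_base_pos hc ht y).le _
  calc ‖g y * profile c t s y‖ = |g y| * profile c t s y := by
        rw [norm_mul, Real.norm_eq_abs, Real.norm_eq_abs, abs_of_nonneg hp0]
    _ ≤ (K * (1 + ‖y‖) ^ m) * (κ ^ (-s) * (1 + ‖y‖) ^ (-(2 * s))) := by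
        gcongr
        exact hb y
    _ = (K * κ ^ (-s)) * ((1 + ‖y‖) ^ (m : ℝ) * (1 + ‖y‖) ^ (-(2 * s))) := by
        rw [Real.rpow_natCast]; ring
    _ = _ := by
        rw [← Real.rpow_add hy]
        congr 2
        ring

lemma integral_mul_coord_mul_profile {m : ℕ} {g g' : En n → ℝ} (a : Fin n)
    (hg : PolyGrowth (m + 1) g) (hd : Differentiable ℝ g) (hg' : PolyGrowth m g')
    (hgg' : ∀ y, pd a g y = g' y)
    (hc : 0 < c) (ht : 0 < t) (hs : (n : ℝ) + m + 1 < 2 * s) :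
    2 * c * s * ∫ y : En n, g y * y a * profile c t (s + 1) y =
      ∫ y : En n, g' y * profile c t s y := by
  have hi := (hg.mul (PolyGrowth.coord a)).integrable_mul_profile (s := s + 1) hc ht
    (by push_cast; linarith)
  have key := integral_mul_fderiv_eq_neg_fderiv_mul_of_integrable (μ := (volume : Measure (En n)))
    (f := g) (g := profile c t s) (v := EuclideanSpace.single a (1 : ℝ)) ?_ ?_ ?_ (fun x _ => hd x)
    (fun y _ => (hasFDerivAt_profile hc ht y).differentiableAt)
  · change ∫ y, g y * pd a (profile c t s) y = - ∫ y, pd a g y * profile c t s y at key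
    simp only [hgg', pd_profile hc ht] at key
    rw [← neg_eq_iff_eq_neg] at key
    rw [← key, ← integral_const_mul, ← integral_neg]
    congr 1
    ext y
    ring
  · change Integrable fun y => pd a g y * profile c t s y
    simp only [hgg']
    exact hg'.integrable_mul_profile hc ht (by linarith)
  · change Integrable fun y => g y * pd a (profile c t s) y
    simp only [pd_profile hc ht]
    refine (hi.const_mul (-(2 * c * s))).congr (Filter.Eventually.of_forall fun y => ?_)
    simp only
    ring
  · exact hg.integrable_mul_profile hc ht (by push_cast; linarith)

end profile

section moments

variable {n : ℕ} {c t s : ℝ}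

lemma pd_coord (i a : Fin n) (x : En n) : pd i (fun y : En n => y a) x = if i = a then 1 else 0 := by
  have h : HasFDerivAt (fun y : En n => y a) (EuclideanSpace.proj a : En n →L[ℝ] ℝ) x :=
    (EuclideanSpace.proj a : En n →L[ℝ] ℝ).hasFDerivAt
  rw [pd, h.fderiv]
  simp [eq_comm]

lemma pd_mul {f g : En n → ℝ} {x : En n} (i : Fin n) (hf : DifferentiableAt ℝ f x)
    (hg : DifferentiableAt ℝ g x) :
    pd i (fun y => f y * g y) x = pd i f x * g x + f x * pd i g x := by
  rw [pd, fderiv_fun_mul hf hg]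
  simp [pd]
  ring

lemma integral_coord_sq_mul_profile (a b : Fin n) (hc : 0 < c) (ht : 0 < t)
    (hs : (n : ℝ) + 1 < 2 * s) :
    2 * c * s * ∫ y : En n, y a * y b * profile c t (s + 1) y =
      (if a = b then 1 else 0) * ∫ y : En n, profile c t s y := by
  rw [integral_mul_coord_mul_profile (m := 0) (g := fun y => y a)
    (g' := fun _ => if a = b then 1 else 0) b ((PolyGrowth.coord a).mono le_rfl) (by fun_prop)
    (PolyGrowth.const _) (fun y => by rw [pd_coord]; simp [eq_comm]) hc ht (by simpa using hs),
    integral_const_mul]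

lemma integral_coord_pow_four_mul_profile (a b d e : Fin n) (hc : 0 < c) (ht : 0 < t)
    (hs : (n : ℝ) + 1 < 2 * s) :
    4 * c ^ 2 * s * (s + 1) * ∫ y : En n, y a * y b * y d * y e * profile c t (s + 2) y =
      ((if a = b then 1 else 0) * (if d = e then 1 else 0) +
        (if a = d then 1 else 0) * (if b = e then 1 else 0) +
        (if a = e then 1 else 0) * (if b = d then 1 else 0)) *
      ∫ y : En n, profile c t s y := by
  have hab (a b : Fin n) : PolyGrowth 2 (fun y : En n => y a * y b) :=
    (PolyGrowth.coord a).mul (PolyGrowth.coord b)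
  have h1 := integral_mul_coord_mul_profile (m := 2) (s := s + 1) (t := t) (c := c)
    (g := fun y : En n => y a * y b * y d)
    (g' := fun y => (if a = e then 1 else 0) * (y b * y d) + (if b = e then 1 else 0) * (y a * y d)
      + (if d = e then 1 else 0) * (y a * y b)) e
    ((hab a b).mul (PolyGrowth.coord d)) (by fun_prop)
    ((((hab b d).const_mul _).add ((hab a d).const_mul _)).add ((hab a b).const_mul _))
    (fun y => by
      rw [pd_mul _ (by fun_prop) (by fun_prop), pd_mul _ (by fun_prop) (by fun_prop)]
      simp only [pd_coord, eq_comm (a := e)]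
      ring) hc ht (by push_cast; linarith)
  have hi (a b : Fin n) (r : ℝ) :
      Integrable (fun y : En n => r * (y a * y b * profile c t (s + 1) y)) :=
    ((hab a b).integrable_mul_profile hc ht (by push_cast; linarith)).const_mul _
  simp only [add_mul, mul_assoc (ite _ _ _)] at h1
  rw [integral_add ((hi _ _ _).fun_add (hi _ _ _)) (hi _ _ _), integral_add (hi _ _ _) (hi _ _ _)] at h1
  simp only [integral_const_mul] at h1
  rw [show s + 1 + 1 = s + 2 by ring] at h1
  have h2 (a b : Fin n) := integral_coord_sq_mul_profile (s := s) (t := t) a b hc ht hs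
  calc _ = 2 * c * s * (2 * c * (s + 1) *
        ∫ y : En n, y a * y b * y d * y e * profile c t (s + 2) y) := by ring
    _ = (if a = e then 1 else 0) * (2 * c * s * ∫ y : En n, y b * y d * profile c t (s + 1) y)
      + (if b = e then 1 else 0) * (2 * c * s * ∫ y : En n, y a * y d * profile c t (s + 1) y)
      + (if d = e then 1 else 0) * (2 * c * s * ∫ y : En n, y a * y b * profile c t (s + 1) y) := by
        rw [h1]; ring
    _ = _ := by rw [h2, h2, h2]; ring

end moments

section Weyl

variable {n : ℕ} {W : Fin n → Fin n → Fin n → Fin n → ℝ}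

/-- The contraction `V_{ipb} = ∑_a W_{iapb} z_a`. -/
def contr (W : Fin n → Fin n → Fin n → Fin n → ℝ) (z : En n) (i p b : Fin n) : ℝ :=
  ∑ a, W i a p b * z a

lemma contr_antisymm (hW : IsWeyl n W) (z : En n) (i p b : Fin n) :
    contr W z i p b = -contr W z i b p := by
  obtain ⟨-, h, -⟩ := hW
  simp only [contr, ← Finset.sum_neg_distrib]
  exact Finset.sum_congr rfl fun a _ => by rw [h i a p b]; ring

lemma contr_cyclic (hW : IsWeyl n W) (z : En n) (i p b : Fin n) :
    contr W z i p b + contr W z p b i + contr W z b i p = 0 := by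
  obtain ⟨-, -, h, -, hB⟩ := hW
  simp only [contr, ← Finset.sum_add_distrib, ← add_mul]
  refine Finset.sum_eq_zero fun a _ => ?_
  rw [h i a p b, h p a b i, h b a i p]
  have := hB p b i a
  rw [show W p b i a + W b i p a + W i p b a = 0 by linarith, zero_mul]

lemma contr_trace (hW : IsWeyl n W) (z : En n) (p : Fin n) : ∑ i, contr W z i p i = 0 := by
  obtain ⟨-, h, -, hT, -⟩ := hW
  simp only [contr]
  rw [Finset.sum_comm]
  refine Finset.sum_eq_zero fun a _ => ?_
  rw [← Finset.sum_mul, Finset.sum_congr rfl fun i _ => h i a p i, Finset.sum_neg_distrib, hT]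
  simp

lemma sum_contr_mul_swap_fst_snd (hW : IsWeyl n W) (z : En n) :
    2 * ∑ i, ∑ p, ∑ b, contr W z i p b * contr W z p i b =
      ∑ i, ∑ p, ∑ b, contr W z i p b ^ 2 := by
  have hX : ∑ i, ∑ p, ∑ b, contr W z i p b * contr W z b i p =
      ∑ i, ∑ p, ∑ b, -(contr W z i p b * contr W z p i b) := by
    refine Finset.sum_congr rfl fun i _ => ?_
    rw [Finset.sum_comm]
    refine Finset.sum_congr rfl fun p _ => Finset.sum_congr rfl fun b _ => ?_
    rw [contr_antisymm hW z i b p]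
    ring
  have h : ∑ i, ∑ p, ∑ b, (contr W z i p b ^ 2 - contr W z i p b * contr W z p i b
      + contr W z i p b * contr W z b i p) = 0 := by
    refine Finset.sum_eq_zero fun i _ => Finset.sum_eq_zero fun p _ =>
      Finset.sum_eq_zero fun b _ => ?_
    have h1 := contr_cyclic hW z i p b
    rw [contr_antisymm hW z p b i] at h1
    linear_combination contr W z i p b * h1
  simp only [Finset.sum_add_distrib, Finset.sum_sub_distrib, hX, Finset.sum_neg_distrib] at h
  linarith

lemma sum_contr_mul_swap_fst_thd (hW : IsWeyl n W) (z : En n) :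
    2 * ∑ i, ∑ p, ∑ b, contr W z i p b * contr W z b p i =
      ∑ i, ∑ p, ∑ b, contr W z i p b ^ 2 := by
  rw [← sum_contr_mul_swap_fst_snd hW]
  congr 1
  refine Finset.sum_congr rfl fun i _ => ?_
  rw [Finset.sum_comm]
  refine Finset.sum_congr rfl fun p _ => Finset.sum_congr rfl fun b _ => ?_
  rw [contr_antisymm hW z i b p, contr_antisymm hW z p b i]
  ring

end Weyl

section Flat

variable {n : ℕ} {f g : En n → ℝ}

open scoped ContDiff

lemma contDiff_pd (hf : ContDiff ℝ ∞ f) (i : Fin n) : ContDiff ℝ ∞ (pd i f) :=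
  (hf.fderiv_right (m := ∞) (by simp)).clm_apply contDiff_const

lemma pd_add {x : En n} (i : Fin n) (hf : DifferentiableAt ℝ f x) (hg : DifferentiableAt ℝ g x) :
    pd i (fun y => f y + g y) x = pd i f x + pd i g x := by
  rw [pd, fderiv_fun_add hf hg]
  rfl

lemma pd_const (i : Fin n) (r : ℝ) (x : En n) : pd i (fun _ => r) x = 0 := by
  simp [pd]

lemma pd_const_mul (i : Fin n) (r : ℝ) {x : En n} (hf : DifferentiableAt ℝ f x) :
    pd i (fun y => r * f y) x = r * pd i f x := by
  rw [pd, fderiv_const_mul hf]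
  rfl

lemma pd_sum {ι : Type*} {s : Finset ι} {F : ι → En n → ℝ} {x : En n} (i : Fin n)
    (h : ∀ j, DifferentiableAt ℝ (F j) x) :
    pd i (fun y => ∑ j ∈ s, F j y) x = ∑ j ∈ s, pd i (F j) x := by
  rw [pd, fderiv_fun_sum fun j _ => h j]
  simp [pd]

/-- Smooth functions whose second derivatives all vanish at the origin. -/
def FlatAtZero (f : En n → ℝ) : Prop :=
  ContDiff ℝ ∞ f ∧ ∀ k l, pd k (fun z => pd l f z) 0 = 0

lemma smooth_differentiable (hf : ContDiff ℝ ∞ f) : Differentiable ℝ f :=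
  hf.differentiable (by simp)

namespace FlatAtZero

lemma const (r : ℝ) : FlatAtZero (fun _ : En n => r) :=
  ⟨contDiff_const, fun k l => by simp [pd_const]⟩

lemma coord (a : Fin n) : FlatAtZero (fun y : En n => y a) :=
  ⟨by fun_prop, fun k l => by simp only [pd_coord, pd_const]⟩

lemma add (hf : FlatAtZero f) (hg : FlatAtZero g) : FlatAtZero (fun y => f y + g y) := by
  refine ⟨hf.1.add hg.1, fun k l => ?_⟩
  have hl : (fun z => pd l (fun y => f y + g y) z) = fun z => pd l f z + pd l g z :=
    funext fun z => pd_add l (smooth_differentiable hf.1 z) (smooth_differentiable hg.1 z)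
  rw [hl, pd_add k (smooth_differentiable (contDiff_pd hf.1 l) 0)
    (smooth_differentiable (contDiff_pd hg.1 l) 0), hf.2, hg.2, add_zero]

lemma const_mul (r : ℝ) (hf : FlatAtZero f) : FlatAtZero (fun y => r * f y) := by
  refine ⟨contDiff_const.mul hf.1, fun k l => ?_⟩
  have hl : (fun z => pd l (fun y => r * f y) z) = fun z => r * pd l f z :=
    funext fun z => pd_const_mul l r (smooth_differentiable hf.1 z)
  rw [hl, pd_const_mul k r (smooth_differentiable (contDiff_pd hf.1 l) 0), hf.2, mul_zero]

lemma sum {ι : Type*} {s : Finset ι} {F : ι → En n → ℝ} (h : ∀ i, FlatAtZero (F i)) :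
    FlatAtZero (fun y => ∑ i ∈ s, F i y) := by
  classical
  induction s using Finset.induction_on with
  | empty => simpa using const (0 : ℝ)
  | insert a s ha ih => simpa only [Finset.sum_insert ha] using (h a).add ih

lemma coord_mul (a : Fin n) (hf : ContDiff ℝ ∞ f) (h1 : ∀ l, pd l f 0 = 0) :
    FlatAtZero (fun z => z a * f z) := by
  have hc : Differentiable ℝ (fun z : En n => z a) := by fun_prop
  refine ⟨ContDiff.mul (by fun_prop) hf, fun k l => ?_⟩
  have hl : (fun z => pd l (fun y => y a * f y) z) =
      fun z => (if l = a then 1 else 0) * f z + z a * pd l f z :=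
    funext fun z => by rw [pd_mul l (hc z) (smooth_differentiable hf z), pd_coord]
  have hf' := smooth_differentiable (contDiff_pd hf l) 0
  have hm : DifferentiableAt ℝ (fun z => z a * pd l f z) 0 := (hc 0).mul hf'
  rw [hl, pd_add k ((smooth_differentiable hf 0).const_mul _) hm,
    pd_const_mul k _ (smooth_differentiable hf 0), pd_mul k (hc 0) hf', h1, h1]
  simp

lemma coord_mul_coord_mul_coord_mul (a b d : Fin n) (hf : ContDiff ℝ ∞ f) :
    FlatAtZero (fun z => z a * (z b * (z d * f z))) := by
  have hd : ContDiff ℝ ∞ (fun z : En n => z d * f z) := ContDiff.mul (by fun_prop) hf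
  refine coord_mul a (ContDiff.mul (by fun_prop) hd) fun l => ?_
  rw [pd_mul l (by fun_prop) (smooth_differentiable hd 0)]
  simp

end FlatAtZero

end Flat

section expansion

variable {n : ℕ} {W : Fin n → Fin n → Fin n → Fin n → ℝ}

/-- Coefficient of `z_a` in `∑_i h_{ip}(y + z) y_i`. -/
def linCoef (W : Fin n → Fin n → Fin n → Fin n → ℝ) (p a : Fin n) (y : En n) : ℝ :=
  (1 / 3) * ∑ i, ∑ b, W i a p b * (y i * y b)

/-- Coefficient of `z_a z_b` in `∑_i h_{ip}(y + z) y_i`. -/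
def quadCoef (W : Fin n → Fin n → Fin n → Fin n → ℝ) (p a b : Fin n) (y : En n) : ℝ :=
  (1 / 3) * ∑ i, W i a p b * y i

lemma polyGrowth_linCoef (p a : Fin n) : PolyGrowth 2 (linCoef W p a) :=
  .const_mul _ <| .sum fun i => .sum fun b =>
    .const_mul _ ((PolyGrowth.coord i).mul (PolyGrowth.coord b))

lemma polyGrowth_quadCoef (p a b : Fin n) : PolyGrowth 1 (quadCoef W p a b) :=
  .const_mul _ <| .sum fun i => .const_mul _ (PolyGrowth.coord i)

/-- The part of `∑_i h_{ip}(y + z) y_i` linear in `z`. -/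
def linPart (W : Fin n → Fin n → Fin n → Fin n → ℝ) (z y : En n) (p : Fin n) : ℝ :=
  ∑ a, z a * linCoef W p a y

/-- The part of `∑_i h_{ip}(y + z) y_i` quadratic in `z`. -/
def quadPart (W : Fin n → Fin n → Fin n → Fin n → ℝ) (z y : En n) (p : Fin n) : ℝ :=
  ∑ a, ∑ b, z a * (z b * quadCoef W p a b y)

lemma linPart_eq_contr (z y : En n) (p : Fin n) :
    linPart W z y p = (1 / 3) * ∑ i, ∑ b, contr W z i p b * (y i * y b) := by
  simp only [linPart, linCoef, contr, Finset.mul_sum, Finset.sum_mul]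
  rw [Finset.sum_comm]
  refine Finset.sum_congr rfl fun i _ => ?_
  rw [Finset.sum_comm]
  refine Finset.sum_congr rfl fun b _ => Finset.sum_congr rfl fun a _ => ?_
  ring

lemma polyGrowth_linPart (z : En n) (p : Fin n) : PolyGrowth 2 (fun y => linPart W z y p) :=
  .sum fun a => .const_mul _ (polyGrowth_linCoef p a)

lemma polyGrowth_quadPart (z : En n) (p : Fin n) : PolyGrowth 1 (fun y => quadPart W z y p) :=
  .sum fun a => .sum fun b => .const_mul _ (.const_mul _ (polyGrowth_quadCoef p a b))

lemma hW_symm (hWeyl : IsWeyl n W) (x : En n) (i p : Fin n) : hW n W x i p = hW n W x p i := by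
  obtain ⟨-, -, h, -⟩ := hWeyl
  simp only [hW]
  rw [Finset.sum_comm]
  congr 1
  refine Finset.sum_congr rfl fun a _ => Finset.sum_congr rfl fun b _ => ?_
  rw [h i b p a]
  ring

lemma sum_weyl_coord_eq_zero (hWeyl : IsWeyl n W) (y : En n) (p b : Fin n) :
    ∑ i, ∑ a, W i a p b * (y i * y a) = 0 := by
  have h : ∑ i, ∑ a, W i a p b * (y i * y a) = -∑ i, ∑ a, W i a p b * (y i * y a) := by
    conv_lhs => rw [Finset.sum_comm]
    simp only [← Finset.sum_neg_distrib]
    refine Finset.sum_congr rfl fun a _ => Finset.sum_congr rfl fun i _ => ?_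
    rw [hWeyl.1 i a p b]
    ring
  linarith

lemma sum_hW_mul_coord (hWeyl : IsWeyl n W) (z y : En n) (p : Fin n) :
    ∑ i, hW n W (y + z) i p * y i = linPart W z y p + quadPart W z y p := by
  have h0 : ∑ i, ∑ a, ∑ b, 1 / 3 * ((y b + z b) * (W i a p b * (y i * y a))) = 0 := by
    have : ∑ b, 1 / 3 * ((y b + z b) * ∑ i, ∑ a, W i a p b * (y i * y a)) = 0 :=
      Finset.sum_eq_zero fun b _ => by rw [sum_weyl_coord_eq_zero hWeyl]; simp
    rw [← this]
    simp only [Finset.mul_sum]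
    exact Finset.sum_comm_cycle
  have h1 : linPart W z y p = ∑ i, ∑ a, ∑ b, 1 / 3 * (W i a p b * (y i * y b) * z a) := by
    simp only [linPart, linCoef, Finset.mul_sum]
    rw [Finset.sum_comm]
    refine Finset.sum_congr rfl fun i _ => Finset.sum_congr rfl fun a _ =>
      Finset.sum_congr rfl fun b _ => ?_
    ring
  have h2 : quadPart W z y p = ∑ i, ∑ a, ∑ b, 1 / 3 * (W i a p b * y i * z a * z b) := by
    simp only [quadPart, quadCoef, Finset.mul_sum]
    rw [Finset.sum_comm_cycle]
    refine Finset.sum_congr rfl fun i _ => Finset.sum_congr rfl fun a _ =>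
      Finset.sum_congr rfl fun b _ => ?_
    ring
  rw [h1, h2, ← zero_add (∑ i, ∑ a, ∑ b, 1 / 3 * (W i a p b * (y i * y b) * z a)), ← h0]
  simp only [← Finset.sum_add_distrib, hW, Finset.mul_sum, Finset.sum_mul]
  refine Finset.sum_congr rfl fun i _ => Finset.sum_congr rfl fun a _ =>
    Finset.sum_congr rfl fun b _ => ?_
  simp only [PiLp.add_apply]
  ring

lemma sum_hW_hW_coord (hWeyl : IsWeyl n W) (z y : En n) :
    ∑ i, ∑ j, ∑ p, hW n W (y + z) i p * hW n W (y + z) p j * y i * y j =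
      ∑ p, (linPart W z y p + quadPart W z y p) ^ 2 := by
  simp only [← sum_hW_mul_coord hWeyl, pow_two, Finset.sum_mul_sum]
  rw [Finset.sum_comm_cycle]
  refine Finset.sum_congr rfl fun p _ => Finset.sum_congr rfl fun i _ =>
    Finset.sum_congr rfl fun j _ => ?_
  rw [hW_symm hWeyl _ p j]
  ring

lemma pd_hW (hWeyl : IsWeyl n W) (i j l : Fin n) (x : En n) :
    pd i (fun y => hW n W y j l) x = (1 / 3) * (contr W x l j i + contr W x j l i) := by
  simp only [hW]
  rw [pd_const_mul _ _ (by fun_prop), pd_sum _ (fun p => by fun_prop)]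
  have h (p q : Fin n) : pd i (fun y : En n => W j p l q * y p * y q) x =
      (if i = p then 1 else 0) * (W j p l q * x q) +
      (if i = q then 1 else 0) * (W j p l q * x p) := by
    rw [pd_mul _ (by fun_prop) (by fun_prop), pd_const_mul _ _ (by fun_prop), pd_coord, pd_coord]
    ring
  have h' (p : Fin n) : pd i (fun y : En n => ∑ q, W j p l q * y p * y q) x =
      ∑ q, pd i (fun y : En n => W j p l q * y p * y q) x := pd_sum _ (fun q => by fun_prop)
  simp only [h', h, Finset.sum_add_distrib, ite_mul, one_mul, zero_mul, Finset.sum_ite_eq,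
    Finset.mem_univ, if_true, contr]
  rw [Finset.sum_comm]
  simp only [Finset.sum_ite_eq, Finset.mem_univ, if_true]
  congr 2
  exact Finset.sum_congr rfl fun q _ => by rw [hWeyl.2.2.1 j i l q]

end expansion

section integrals

variable {n : ℕ} {W : Fin n → Fin n → Fin n → Fin n → ℝ} {c t s : ℝ}

lemma sum_delta_pairings (V : Fin n → Fin n → ℝ) :
    ∑ i, ∑ b, ∑ i', ∑ b', V i b * V i' b' *
      ((if i = b then 1 else 0) * (if i' = b' then 1 else 0) +
        (if i = i' then 1 else 0) * (if b = b' then 1 else 0) +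
        (if i = b' then 1 else 0) * (if b = i' then 1 else 0)) =
      (∑ i, V i i) ^ 2 + ∑ i, ∑ b, V i b ^ 2 + ∑ i, ∑ b, V i b * V b i := by
  simp [mul_add, Finset.sum_add_distrib, pow_two, Finset.sum_mul_sum]

lemma integral_linPart_sq (hWeyl : IsWeyl n W) (z : En n) (hc : 0 < c) (ht : 0 < t)
    (hs : (n : ℝ) + 1 < 2 * s) :
    4 * c ^ 2 * s * (s + 1) * ∫ y : En n, (∑ p, linPart W z y p ^ 2) * profile c t (s + 2) y =
      (1 / 6) * (∑ i, ∑ p, ∑ b, contr W z i p b ^ 2) * ∫ y : En n, profile c t s y := by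
  have hpt (y : En n) : (∑ p, linPart W z y p ^ 2) * profile c t (s + 2) y =
      ∑ p, ∑ i, ∑ b, ∑ i', ∑ b', (1 / 9 * (contr W z i p b * contr W z i' p b')) *
        (y i * y b * y i' * y b' * profile c t (s + 2) y) := by
    rw [Finset.sum_mul]
    refine Finset.sum_congr rfl fun p _ => ?_
    rw [linPart_eq_contr, mul_pow, pow_two (∑ i, _)]
    simp only [Finset.sum_mul]
    simp only [Finset.mul_sum, Finset.sum_mul]
    refine Finset.sum_congr rfl fun i _ => Finset.sum_congr rfl fun b _ =>
      Finset.sum_congr rfl fun i' _ => Finset.sum_congr rfl fun b' _ => ?_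
    ring
  have hi (r : ℝ) (i b i' b' : Fin n) : Integrable (fun y : En n =>
      r * (y i * y b * y i' * y b' * profile c t (s + 2) y)) :=
    ((((((PolyGrowth.coord i).mul (PolyGrowth.coord b)).mul (PolyGrowth.coord i')).mul
      (PolyGrowth.coord b')).integrable_mul_profile hc ht (by push_cast; linarith))).const_mul _
  have hint : ∫ y : En n, (∑ p, linPart W z y p ^ 2) * profile c t (s + 2) y =
      ∑ p, ∑ i, ∑ b, ∑ i', ∑ b', (1 / 9 * (contr W z i p b * contr W z i' p b')) *
        ∫ y : En n, y i * y b * y i' * y b' * profile c t (s + 2) y := by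
    simp only [hpt]
    rw [integral_finsetSum _ fun p _ => integrable_finsetSum _ fun i _ => integrable_finsetSum _
      fun b _ => integrable_finsetSum _ fun i' _ => integrable_finsetSum _ fun b' _ => hi _ _ _ _ _]
    refine Finset.sum_congr rfl fun p _ => ?_
    rw [integral_finsetSum _ fun i _ => integrable_finsetSum _
      fun b _ => integrable_finsetSum _ fun i' _ => integrable_finsetSum _ fun b' _ => hi _ _ _ _ _]
    refine Finset.sum_congr rfl fun i _ => ?_
    rw [integral_finsetSum _
      fun b _ => integrable_finsetSum _ fun i' _ => integrable_finsetSum _ fun b' _ => hi _ _ _ _ _]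
    refine Finset.sum_congr rfl fun b _ => ?_
    rw [integral_finsetSum _ fun i' _ => integrable_finsetSum _ fun b' _ => hi _ _ _ _ _]
    refine Finset.sum_congr rfl fun i' _ => ?_
    rw [integral_finsetSum _ fun b' _ => hi _ _ _ _ _]
    exact Finset.sum_congr rfl fun b' _ => integral_const_mul _ _
  have hsum : ∑ p, ((∑ i, contr W z i p i) ^ 2 + ∑ i, ∑ b, contr W z i p b ^ 2
      + ∑ i, ∑ b, contr W z i p b * contr W z b p i) =
      (3 / 2) * ∑ i, ∑ p, ∑ b, contr W z i p b ^ 2 := by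
    simp only [contr_trace hWeyl, Finset.sum_add_distrib]
    rw [Finset.sum_comm (f := fun p i => ∑ b, contr W z i p b ^ 2),
      Finset.sum_comm (f := fun p i => ∑ b, contr W z i p b * contr W z b p i)]
    have := sum_contr_mul_swap_fst_thd hWeyl z
    simp
    linarith
  calc _ = ∑ p, ∑ i, ∑ b, ∑ i', ∑ b', 1 / 9 * (contr W z i p b * contr W z i' p b') *
        (4 * c ^ 2 * s * (s + 1) *
          ∫ y : En n, y i * y b * y i' * y b' * profile c t (s + 2) y) := by
        rw [hint]
        simp only [Finset.mul_sum]
        refine Finset.sum_congr rfl fun p _ => Finset.sum_congr rfl fun i _ =>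
          Finset.sum_congr rfl fun b _ => Finset.sum_congr rfl fun i' _ =>
          Finset.sum_congr rfl fun b' _ => ?_
        ring
    _ = 1 / 9 * (∑ p, ∑ i, ∑ b, ∑ i', ∑ b', contr W z i p b * contr W z i' p b' *
      ((if i = b then 1 else 0) * (if i' = b' then 1 else 0) +
        (if i = i' then 1 else 0) * (if b = b' then 1 else 0) +
        (if i = b' then 1 else 0) * (if b = i' then 1 else 0))) *
          ∫ y : En n, profile c t s y := by
        simp only [integral_coord_pow_four_mul_profile _ _ _ _ hc ht hs, Finset.mul_sum,
          Finset.sum_mul]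
        refine Finset.sum_congr rfl fun p _ => Finset.sum_congr rfl fun i _ =>
          Finset.sum_congr rfl fun b _ => Finset.sum_congr rfl fun i' _ =>
          Finset.sum_congr rfl fun b' _ => ?_
        ring
    _ = _ := by
        rw [Finset.sum_congr rfl fun p _ => sum_delta_pairings fun i b => contr W z i p b, hsum]
        ring

/-- The partial derivative `∂_i h_{jl}`. -/
def gradCoef (W : Fin n → Fin n → Fin n → Fin n → ℝ) (i j l : Fin n) (x : En n) : ℝ :=
  (1 / 3) * (contr W x l j i + contr W x j l i)

lemma contr_add (y z : En n) (i p b : Fin n) :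
    contr W (y + z) i p b = contr W y i p b + contr W z i p b := by
  simp [contr, mul_add, Finset.sum_add_distrib]

lemma sum_gradCoef_sq (hWeyl : IsWeyl n W) (z : En n) :
    ∑ i, ∑ j, ∑ l, gradCoef W i j l z ^ 2 =
      (1 / 3) * ∑ i, ∑ p, ∑ b, contr W z i p b ^ 2 := by
  have h : ∑ i, ∑ j, ∑ l, gradCoef W i j l z ^ 2 =
      (1 / 9) * (∑ j, ∑ l, ∑ i, contr W z l j i ^ 2 + ∑ j, ∑ l, ∑ i, contr W z j l i ^ 2
        + 2 * ∑ j, ∑ l, ∑ i, contr W z j l i * contr W z l j i) := by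
    simp only [← Finset.sum_add_distrib, Finset.mul_sum]
    rw [← Finset.sum_comm_cycle]
    refine Finset.sum_congr rfl fun i _ => Finset.sum_congr rfl fun j _ =>
      Finset.sum_congr rfl fun l _ => ?_
    rw [gradCoef]
    ring
  rw [h, sum_contr_mul_swap_fst_snd hWeyl,
    Finset.sum_comm (f := fun j l => ∑ i, contr W z l j i ^ 2)]
  ring

lemma polyGrowth_gradCoef (i j l : Fin n) : PolyGrowth 1 (gradCoef W i j l) :=
  .const_mul _ <| .add (.sum fun _ => .const_mul _ (.coord _)) (.sum fun _ => .const_mul _ (.coord _))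

lemma flatAtZero_gradCoef (i j l : Fin n) : FlatAtZero (gradCoef W i j l) :=
  .const_mul _ <| .add (.sum fun _ => .const_mul _ (.coord _)) (.sum fun _ => .const_mul _ (.coord _))

lemma integral_gradCoef_sq_shift (hWeyl : IsWeyl n W) (hc : 0 < c) (ht : 0 < t)
    (hs : (n : ℝ) + 2 < 2 * s) : ∃ L : En n → ℝ, FlatAtZero L ∧ ∀ z : En n,
    ∫ y : En n, (∑ i, ∑ j, ∑ l, gradCoef W i j l (y + z) ^ 2) * profile c t s y =
      L z + (1 / 3) * (∑ i, ∑ p, ∑ b, contr W z i p b ^ 2) * ∫ y : En n, profile c t s y := by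
  have h0 : Integrable (fun y : En n => profile c t s y) := by
    simpa using (PolyGrowth.const (n := n) 1).integrable_mul_profile hc ht
      (by push_cast; linarith)
  have h1 (i j l : Fin n) (r : ℝ) :
      Integrable (fun y : En n => r * (gradCoef W i j l y * profile c t s y)) :=
    ((polyGrowth_gradCoef i j l).integrable_mul_profile hc ht (by push_cast; linarith)).const_mul _
  have h2 : Integrable (fun y : En n => (∑ i, ∑ j, ∑ l, gradCoef W i j l y ^ 2) *
      profile c t s y) :=
    PolyGrowth.integrable_mul_profile (m := 2) (.sum fun i => .sum fun j => .sum fun l =>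
      (polyGrowth_gradCoef i j l).sq) hc ht (by push_cast; linarith)
  refine ⟨fun z => (∫ y : En n, (∑ i, ∑ j, ∑ l, gradCoef W i j l y ^ 2) * profile c t s y) +
    2 * ∑ i, ∑ j, ∑ l, (∫ y : En n, gradCoef W i j l y * profile c t s y) * gradCoef W i j l z,
    .add (.const _) (.const_mul _ (.sum fun i => .sum fun j => .sum fun l =>
      .const_mul _ (flatAtZero_gradCoef i j l))), fun z => ?_⟩
  have hpt (y : En n) : (∑ i, ∑ j, ∑ l, gradCoef W i j l (y + z) ^ 2) * profile c t s y =
      (∑ i, ∑ j, ∑ l, gradCoef W i j l y ^ 2) * profile c t s y +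
      (∑ i, ∑ j, ∑ l, (2 * gradCoef W i j l z) * (gradCoef W i j l y * profile c t s y)) +
      (∑ i, ∑ j, ∑ l, gradCoef W i j l z ^ 2) * profile c t s y := by
    simp only [Finset.sum_mul, ← Finset.sum_add_distrib]
    refine Finset.sum_congr rfl fun i _ => Finset.sum_congr rfl fun j _ =>
      Finset.sum_congr rfl fun l _ => ?_
    simp only [gradCoef, contr_add]
    ring
  have h3 : Integrable (fun y : En n => ∑ i, ∑ j, ∑ l, (2 * gradCoef W i j l z) *
      (gradCoef W i j l y * profile c t s y)) :=
    integrable_finsetSum _ fun i _ => integrable_finsetSum _ fun j _ => integrable_finsetSum _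
      fun l _ => h1 _ _ _ _
  simp only [hpt]
  rw [integral_add (h2.fun_add h3) (h0.const_mul _), integral_add h2 h3, integral_const_mul,
    sum_gradCoef_sq hWeyl]
  congr 2
  rw [integral_finsetSum _ fun i _ => integrable_finsetSum _ fun j _ => integrable_finsetSum _
    fun l _ => h1 _ _ _ _, Finset.mul_sum]
  refine Finset.sum_congr rfl fun i _ => ?_
  rw [integral_finsetSum _ fun j _ => integrable_finsetSum _ fun l _ => h1 _ _ _ _, Finset.mul_sum]
  refine Finset.sum_congr rfl fun j _ => ?_
  rw [integral_finsetSum _ fun l _ => h1 _ _ _ _, Finset.mul_sum]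
  refine Finset.sum_congr rfl fun l _ => ?_
  rw [integral_const_mul]
  ring

lemma integral_linPart_add_quadPart_sq (hc : 0 < c) (ht : 0 < t) (hs : (n : ℝ) + 4 < 2 * s) :
    ∃ R : En n → ℝ, FlatAtZero R ∧ ∀ z : En n,
    ∫ y : En n, (∑ p, (linPart W z y p + quadPart W z y p) ^ 2) * profile c t s y =
      (∫ y : En n, (∑ p, linPart W z y p ^ 2) * profile c t s y) + R z := by
  set K : Fin n → Fin n → Fin n → Fin n → ℝ := fun p a b d =>
    ∫ y : En n, 2 * linCoef W p a y * quadCoef W p b d y * profile c t s y with hK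
  set K' : Fin n → Fin n → Fin n → Fin n → Fin n → ℝ := fun p a b d e =>
    ∫ y : En n, quadCoef W p a b y * quadCoef W p d e y * profile c t s y with hK'
  have hi (p a b d : Fin n) : Integrable (fun y : En n =>
      2 * linCoef W p a y * quadCoef W p b d y * profile c t s y) :=
    (((polyGrowth_linCoef p a).const_mul 2).mul (polyGrowth_quadCoef p b d)).integrable_mul_profile
      hc ht (by push_cast; linarith)
  have hi' (p a b d e : Fin n) : Integrable (fun y : En n =>
      quadCoef W p a b y * quadCoef W p d e y * profile c t s y) :=
    ((polyGrowth_quadCoef p a b).mul (polyGrowth_quadCoef p d e)).integrable_mul_profile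
      hc ht (by push_cast; linarith)
  refine ⟨fun z => ∑ p, ∑ a, ∑ b, ∑ d, z a * (z b * (z d * (K p a b d + ∑ e, z e * K' p a b d e))),
    .sum fun p => .sum fun a => .sum fun b => .sum fun d =>
      .coord_mul_coord_mul_coord_mul a b d (by fun_prop), fun z => ?_⟩
  set G : Fin n → Fin n → Fin n → Fin n → En n → ℝ := fun p a b d y =>
    2 * linCoef W p a y * quadCoef W p b d y * profile c t s y +
      ∑ e, z e * (quadCoef W p a b y * quadCoef W p d e y * profile c t s y) with hG
  have hiS (p a b d : Fin n) : Integrable (fun y : En n =>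
      ∑ e, z e * (quadCoef W p a b y * quadCoef W p d e y * profile c t s y)) :=
    integrable_finsetSum _ fun e _ => (hi' p a b d e).const_mul _
  have hGi (p a b d : Fin n) (r : ℝ) : Integrable (fun y => r * G p a b d y) :=
    ((hi p a b d).fun_add (hiS p a b d)).const_mul r
  have hGint (p a b d : Fin n) : ∫ y, G p a b d y = K p a b d + ∑ e, z e * K' p a b d e := by
    rw [hG, integral_add (hi p a b d) (hiS p a b d),
      integral_finsetSum _ fun e _ => (hi' p a b d e).const_mul _]
    simp only [integral_const_mul, hK, hK']
  have hlq (y : En n) (p : Fin n) : linPart W z y p * quadPart W z y p =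
      ∑ a, ∑ b, ∑ d, z a * z b * z d * (linCoef W p a y * quadCoef W p b d y) := by
    simp only [linPart, quadPart, Finset.sum_mul]
    simp only [Finset.mul_sum]
    refine Finset.sum_congr rfl fun a _ => Finset.sum_congr rfl fun b _ =>
      Finset.sum_congr rfl fun d _ => ?_
    ring
  have hqq (y : En n) (p : Fin n) : quadPart W z y p ^ 2 =
      ∑ a, ∑ b, ∑ d, z a * z b * z d * ∑ e, z e * (quadCoef W p a b y * quadCoef W p d e y) := by
    simp only [quadPart, pow_two, Finset.sum_mul]
    simp only [Finset.mul_sum]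
    refine Finset.sum_congr rfl fun a _ => Finset.sum_congr rfl fun b _ =>
      Finset.sum_congr rfl fun d _ => Finset.sum_congr rfl fun e _ => ?_
    ring
  have hpt (y : En n) :
      (∑ p, (linPart W z y p + quadPart W z y p) ^ 2) * profile c t s y =
        (∑ p, linPart W z y p ^ 2) * profile c t s y +
          ∑ p, ∑ a, ∑ b, ∑ d, (z a * z b * z d) * G p a b d y := by
    rw [Finset.sum_mul, Finset.sum_mul, ← Finset.sum_add_distrib]
    refine Finset.sum_congr rfl fun p _ => ?_
    rw [add_sq, mul_assoc 2, hlq, hqq, add_assoc, add_mul]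
    congr 1
    simp only [Finset.mul_sum, ← Finset.sum_add_distrib, Finset.sum_mul, hG, mul_add, add_mul]
    refine Finset.sum_congr rfl fun a _ => Finset.sum_congr rfl fun b _ =>
      Finset.sum_congr rfl fun d _ => ?_
    congr 1
    · ring
    · exact Finset.sum_congr rfl fun e _ => by ring
  simp only [hpt]
  have hlin : Integrable (fun y : En n => (∑ p, linPart W z y p ^ 2) * profile c t s y) :=
    PolyGrowth.integrable_mul_profile (m := 4) (.sum fun p => (polyGrowth_linPart z p).sq)
      hc ht (by push_cast; linarith)
  rw [integral_add hlin (integrable_finsetSum _ fun p _ => integrable_finsetSum _ fun a _ =>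
    integrable_finsetSum _ fun b _ => integrable_finsetSum _ fun d _ => hGi _ _ _ _ _)]
  congr 1
  rw [integral_finsetSum _ fun p _ => integrable_finsetSum _ fun a _ =>
    integrable_finsetSum _ fun b _ => integrable_finsetSum _ fun d _ => hGi _ _ _ _ _]
  refine Finset.sum_congr rfl fun p _ => ?_
  rw [integral_finsetSum _ fun a _ =>
    integrable_finsetSum _ fun b _ => integrable_finsetSum _ fun d _ => hGi _ _ _ _ _]
  refine Finset.sum_congr rfl fun a _ => ?_
  rw [integral_finsetSum _ fun b _ => integrable_finsetSum _ fun d _ => hGi _ _ _ _ _]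
  refine Finset.sum_congr rfl fun b _ => ?_
  rw [integral_finsetSum _ fun d _ => hGi _ _ _ _ _]
  refine Finset.sum_congr rfl fun d _ => ?_
  rw [integral_const_mul, hGint]
  ring

end integrals

section bubble

variable {n : ℕ} {W : Fin n → Fin n → Fin n → Fin n → ℝ} {t : ℝ}

lemma Bub_eq_profile (z : En n) :
    Bub n t z = fun x => t ^ (((n : ℝ) - 2) / 2) *
      profile ((n : ℝ) * ((n : ℝ) - 2))⁻¹ t (((n : ℝ) - 2) / 2) (x - z) := by
  ext x
  rw [Bub, profile, div_eq_inv_mul (‖x - z‖ ^ 2)]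

lemma pd_Bub (hn : 2 < n) (ht : 0 < t) (z y : En n) (i : Fin n) :
    pd i (Bub n t z) (y + z) = -(t ^ (((n : ℝ) - 2) / 2) * ((n : ℝ) * ((n : ℝ) - 2))⁻¹ *
      ((n : ℝ) - 2)) * (y i * profile ((n : ℝ) * ((n : ℝ) - 2))⁻¹ t ((n : ℝ) / 2) y) := by
  have hn' : (2 : ℝ) < n := by exact_mod_cast hn
  have hc : 0 < ((n : ℝ) * ((n : ℝ) - 2))⁻¹ := inv_pos.2 (mul_pos (by linarith) (by linarith))
  have h := pd_profile (s := ((n : ℝ) - 2) / 2) hc ht i y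
  rw [Bub_eq_profile, pd, fderiv_comp_sub
    (f := fun x => t ^ (((n : ℝ) - 2) / 2) *
      profile ((n : ℝ) * ((n : ℝ) - 2))⁻¹ t (((n : ℝ) - 2) / 2) x), add_sub_cancel_right]
  change pd i _ y = _
  rw [pd_const_mul _ _ (hasFDerivAt_profile hc ht y).differentiableAt, h,
    show ((n : ℝ) - 2) / 2 + 1 = n / 2 by ring]
  ring

lemma F1_eq (hWeyl : IsWeyl n W) (hn : 2 < n) (ht : 0 < t) (z : En n) :
    F1 n W t z = (1 / 4) * ((t ^ (((n : ℝ) - 2) / 2) * ((n : ℝ) * ((n : ℝ) - 2))⁻¹ *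
      ((n : ℝ) - 2)) ^ 2 * ∫ y : En n, (∑ p, (linPart W z y p + quadPart W z y p) ^ 2) *
        profile ((n : ℝ) * ((n : ℝ) - 2))⁻¹ t n y) := by
  have hn' : (2 : ℝ) < n := by exact_mod_cast hn
  have hc : 0 < ((n : ℝ) * ((n : ℝ) - 2))⁻¹ := inv_pos.2 (mul_pos (by linarith) (by linarith))
  rw [F1, ← integral_add_right_eq_self _ z]
  congr 1
  rw [← integral_const_mul]
  congr 1
  ext y
  simp only [pd_Bub hn ht]
  rw [← sum_hW_hW_coord hWeyl]
  have h := profile_mul_self (s := (n : ℝ) / 2) hc ht y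
  rw [mul_div_cancel₀ _ (two_ne_zero)] at h
  rw [← h]
  simp only [Finset.sum_mul, Finset.mul_sum]
  refine Finset.sum_congr rfl fun i _ => Finset.sum_congr rfl fun j _ =>
    Finset.sum_congr rfl fun p _ => ?_
  ring

lemma F2_eq (hWeyl : IsWeyl n W) (hn : 2 < n) (ht : 0 < t) (z : En n) :
    F2 n W t z = -(((n : ℝ) - 2) / (32 * ((n : ℝ) - 1))) * ((t ^ (((n : ℝ) - 2) / 2)) ^ 2 *
      ∫ y : En n, (∑ i, ∑ j, ∑ l, gradCoef W i j l (y + z) ^ 2) *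
        profile ((n : ℝ) * ((n : ℝ) - 2))⁻¹ t ((n : ℝ) - 2) y) := by
  have hn' : (2 : ℝ) < n := by exact_mod_cast hn
  have hc : 0 < ((n : ℝ) * ((n : ℝ) - 2))⁻¹ := inv_pos.2 (mul_pos (by linarith) (by linarith))
  rw [F2, ← integral_add_right_eq_self _ z]
  congr 1
  rw [← integral_const_mul]
  congr 1
  ext y
  have h := profile_mul_self (s := ((n : ℝ) - 2) / 2) hc ht y
  rw [mul_div_cancel₀ _ (two_ne_zero)] at h
  simp only [pd_hW hWeyl, Bub_eq_profile, add_sub_cancel_right, gradCoef, ← h]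
  ring

end bubble

theorem stmt14 (n : ℕ) (hn : 11 ≤ n) (W : Fin n → Fin n → Fin n → Fin n → ℝ)
    (hWeyl : IsWeyl n W) (t : ℝ) (ht : 0 < t) (k l : Fin n) :
    pd k (fun z => pd l (fun z' => F1 n W t z' + F2 n W t z') z) (0 : En n) = 0 := by
  have hn' : (11 : ℝ) ≤ n := by exact_mod_cast hn
  have hc : 0 < ((n : ℝ) * ((n : ℝ) - 2))⁻¹ := inv_pos.2 (mul_pos (by linarith) (by linarith))
  obtain ⟨R, hR, hR'⟩ := integral_linPart_add_quadPart_sq (W := W) hc ht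
    (s := (n : ℝ)) (by linarith)
  obtain ⟨L, hL, hL'⟩ := integral_gradCoef_sq_shift hWeyl hc ht (s := (n : ℝ) - 2) (by linarith)
  have hF : (fun z => F1 n W t z + F2 n W t z) = fun z =>
      (1 / 4 * (t ^ (((n : ℝ) - 2) / 2) * ((n : ℝ) * ((n : ℝ) - 2))⁻¹ * ((n : ℝ) - 2)) ^ 2) * R z +
      (-(((n : ℝ) - 2) / (32 * ((n : ℝ) - 1))) * (t ^ (((n : ℝ) - 2) / 2)) ^ 2) * L z := by
    ext z
    have hq := integral_linPart_sq hWeyl z hc ht (s := (n : ℝ) - 2) (by linarith)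
    rw [sub_add_cancel] at hq
    rw [F1_eq hWeyl (by omega) ht, F2_eq hWeyl (by omega) ht, hR', hL']
    set c := ((n : ℝ) * ((n : ℝ) - 2))⁻¹
    set I := ∫ y : En n, profile c t ((n : ℝ) - 2) y
    set J := ∫ y : En n, (∑ p, linPart W z y p ^ 2) * profile c t n y
    set S := ∑ i, ∑ p, ∑ b, contr W z i p b ^ 2
    set τ := t ^ (((n : ℝ) - 2) / 2)
    have h1 : (n : ℝ) - 1 ≠ 0 := by linarith
    field_simp
    linear_combination 24 * ((n : ℝ) - 2) * τ ^ 2 * hq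
  rw [hF]
  exact ((hR.const_mul _).add (hL.const_mul _)).2 k l
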